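/- arXiv:2111.13399 — 2 statements merged into one kernel-verified Lean document; each statement's English description precedes it below -/
import Mathlib

section
/- Let p ≥ q ≥ 1 and let A, B be complex p×q matrices. For any subset {i_1 < i_2 < … < i_r} of [q], the Lidskii inequality ∑_{k=1}^r τ_{i_k}(A+B) ≤ ∑_{k=1}^r τ_{i_k}(B) + ∑_{k=1}^r τ_k(A) holds. -/
open Matrix

/-- The eigenvalues of a Hermitian matrix, listed in decreasing order. -/
noncomputable def eigsDesc {n : ℕ} {A : Matrix (Fin n) (Fin n) ℂ} (hA : A.IsHermitian) :
    Fin n → ℝ :=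
  fun i => hA.eigenvalues (Tuple.sort hA.eigenvalues i.rev)

/-- The singular values of a complex `p × q` matrix, listed in decreasing order:
the square roots of the eigenvalues of the Hermitian matrix `Aᴴ * A`. -/
noncomputable def singularValues {p q : ℕ} (A : Matrix (Fin p) (Fin q) ℂ) : Fin q → ℝ :=
  fun i => Real.sqrt (eigsDesc (Matrix.isHermitian_conjTranspose_mul_self A) i)

/-- `sval A k` is the `k`-th singular value `τ_k(A)` of `A`, with 1-based indexing
(junk value `0` out of range). -/
noncomputable def sval {p q : ℕ} (A : Matrix (Fin p) (Fin q) ℂ) (k : ℕ) : ℝ :=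
  if h : k - 1 < q then singularValues A ⟨k - 1, h⟩ else 0

section Eigenvalues

variable {𝕜 : Type*} [RCLike 𝕜] {n : ℕ}
  {E : Type*} [NormedAddCommGroup E] [InnerProductSpace 𝕜 E]

/-- A linear map acting diagonally on an orthonormal basis has a diagonal quadratic form. -/
lemma OrthonormalBasis.re_inner_apply_of_diagonal (b : OrthonormalBasis (Fin n) 𝕜 E)
    {T : E →ₗ[𝕜] E} {c : Fin n → ℝ} (h : ∀ x j, b.repr (T x) j = c j * b.repr x j) (x : E) :
    RCLike.re (inner 𝕜 x (T x)) = ∑ j, c j * ‖b.repr x j‖ ^ 2 := by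
  rw [← b.repr.inner_map_map, PiLp.inner_apply, map_sum]
  refine Finset.sum_congr rfl fun j _ => ?_
  rw [h, RCLike.inner_apply, mul_assoc, RCLike.mul_conj, ← RCLike.ofReal_pow, ← RCLike.ofReal_mul,
    RCLike.ofReal_re]

lemma OrthonormalBasis.norm_sq_eq_sum_repr (b : OrthonormalBasis (Fin n) 𝕜 E) (x : E) :
    ‖x‖ ^ 2 = ∑ j, ‖b.repr x j‖ ^ 2 := by
  rw [← b.repr.norm_map, EuclideanSpace.norm_sq_eq]

lemma OrthonormalBasis.sum_mul_norm_sq_le (b : OrthonormalBasis (Fin n) 𝕜 E)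
    {c : Fin n → ℝ} (hc : Antitone c) {i : Fin n} {x : E} (hx : ∀ j < i, b.repr x j = 0) :
    ∑ j, c j * ‖b.repr x j‖ ^ 2 ≤ c i * ‖x‖ ^ 2 := by
  rw [b.norm_sq_eq_sum_repr x, Finset.mul_sum]
  refine Finset.sum_le_sum fun j _ => ?_
  rcases lt_or_ge j i with hj | hj
  · simp [hx j hj]
  · exact mul_le_mul_of_nonneg_right (hc hj) (by positivity)

lemma OrthonormalBasis.le_sum_mul_norm_sq (b : OrthonormalBasis (Fin n) 𝕜 E)
    {c : Fin n → ℝ} (hc : Antitone c) {i : Fin n} {x : E} (hx : ∀ j > i, b.repr x j = 0) :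
    c i * ‖x‖ ^ 2 ≤ ∑ j, c j * ‖b.repr x j‖ ^ 2 := by
  rw [b.norm_sq_eq_sum_repr x, Finset.mul_sum]
  refine Finset.sum_le_sum fun j _ => ?_
  rcases lt_or_ge i j with hj | hj
  · simp [hx j hj]
  · exact mul_le_mul_of_nonneg_right (hc hj) (by positivity)

/-- The linear map acting on an orthonormal basis by real scalars. -/
noncomputable def OrthonormalBasis.diagonalMap (b : OrthonormalBasis (Fin n) 𝕜 E)
    (c : Fin n → ℝ) : E →ₗ[𝕜] E :=
  b.toBasis.constr 𝕜 fun j => (c j : 𝕜) • b j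

lemma OrthonormalBasis.diagonalMap_apply_self (b : OrthonormalBasis (Fin n) 𝕜 E)
    (c : Fin n → ℝ) (j : Fin n) : b.diagonalMap c (b j) = (c j : 𝕜) • b j := by
  have := b.toBasis.constr_basis 𝕜 (fun j => (c j : 𝕜) • b j) j
  rwa [b.coe_toBasis] at this

lemma OrthonormalBasis.repr_diagonalMap (b : OrthonormalBasis (Fin n) 𝕜 E)
    (c : Fin n → ℝ) (x : E) (j : Fin n) :
    b.repr (b.diagonalMap c x) j = c j * b.repr x j := by
  conv_lhs => rw [← b.sum_repr x]
  simp only [map_sum, map_smul, b.diagonalMap_apply_self, WithLp.ofLp_sum, Finset.sum_apply,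
    PiLp.smul_apply, OrthonormalBasis.repr_self, smul_eq_mul, PiLp.single_apply]
  simp [mul_comm]

lemma OrthonormalBasis.isSymmetric_diagonalMap (b : OrthonormalBasis (Fin n) 𝕜 E)
    (c : Fin n → ℝ) : (b.diagonalMap c).IsSymmetric := by
  intro x y
  rw [← b.repr.inner_map_map, ← b.repr.inner_map_map x, PiLp.inner_apply, PiLp.inner_apply]
  refine Finset.sum_congr rfl fun j _ => ?_
  simp only [b.repr_diagonalMap, RCLike.inner_apply, map_mul, RCLike.conj_ofReal]
  ring

variable [FiniteDimensional 𝕜 E]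

/-- The span of the first `i + 1` vectors of one basis meets the span of all but the first `i`
vectors of another. -/
lemma OrthonormalBasis.exists_ne_zero_repr_eq_zero (u v : OrthonormalBasis (Fin n) 𝕜 E)
    (i : Fin n) : ∃ x : E, x ≠ 0 ∧ (∀ j > i, u.repr x j = 0) ∧ ∀ j < i, v.repr x j = 0 := by
  let f : E →ₗ[𝕜] ({j : Fin n // j ≠ i} → 𝕜) := LinearMap.pi fun j =>
    if i < j.1 then u.toBasis.coord j.1 else v.toBasis.coord j.1
  have hker : LinearMap.ker f ≠ ⊥ := by
    apply LinearMap.ker_ne_bot_of_finrank_lt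
    have hn : Module.finrank 𝕜 E = n := by
      simpa using Module.finrank_eq_card_basis u.toBasis
    have := i.pos
    simp only [Module.finrank_fintype_fun_eq_card, hn, Fintype.card_subtype_compl,
      Fintype.card_fin, Fintype.card_unique, ne_eq]
    omega
  obtain ⟨x, hx, hx0⟩ := (Submodule.ne_bot_iff _).mp hker
  have hx' (j : Fin n) (hj : j ≠ i) : f x ⟨j, hj⟩ = 0 := by
    rw [LinearMap.mem_ker.mp hx]; rfl
  refine ⟨x, hx0, fun j hj => ?_, fun j hj => ?_⟩
  · simpa [f, hj] using hx' j hj.ne'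
  · simpa [f, hj.not_gt] using hx' j hj.ne

/-- The Courant–Fischer comparison principle. -/
lemma OrthonormalBasis.le_of_forall_le (u v : OrthonormalBasis (Fin n) 𝕜 E) (i : Fin n)
    {Q : E → ℝ} {s t : ℝ} (hs : ∀ x, (∀ j > i, u.repr x j = 0) → s * ‖x‖ ^ 2 ≤ Q x)
    (ht : ∀ x, (∀ j < i, v.repr x j = 0) → Q x ≤ t * ‖x‖ ^ 2) : s ≤ t := by
  obtain ⟨x, hx0, hu, hv⟩ := u.exists_ne_zero_repr_eq_zero v i
  have : 0 < ‖x‖ ^ 2 := by positivity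
  exact le_of_mul_le_mul_right ((hs x hu).trans (ht x hv)) this

namespace LinearMap.IsSymmetric

variable {S T M N : E →ₗ[𝕜] E}

lemma re_inner_apply_eq_sum (hT : T.IsSymmetric) (hn : Module.finrank 𝕜 E = n) (x : E) :
    RCLike.re (inner 𝕜 x (T x)) =
      ∑ j, hT.eigenvalues hn j * ‖(hT.eigenvectorBasis hn).repr x j‖ ^ 2 :=
  (hT.eigenvectorBasis hn).re_inner_apply_of_diagonal
    (hT.eigenvectorBasis_apply_self_apply hn) x

/-- Weyl's monotonicity principle. -/
lemma eigenvalues_le_add (hS : S.IsSymmetric) (hT : T.IsSymmetric)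
    (hn : Module.finrank 𝕜 E = n) {t : ℝ}
    (h : ∀ x, RCLike.re (inner 𝕜 x (S x)) ≤ RCLike.re (inner 𝕜 x (T x)) + t * ‖x‖ ^ 2)
    (i : Fin n) : hS.eigenvalues hn i ≤ hT.eigenvalues hn i + t := by
  refine (hS.eigenvectorBasis hn).le_of_forall_le (hT.eigenvectorBasis hn) i
    (Q := fun x => RCLike.re (inner 𝕜 x (S x))) (fun x hx => ?_) (fun x hx => ?_)
  · rw [hS.re_inner_apply_eq_sum hn]
    exact OrthonormalBasis.le_sum_mul_norm_sq _ (hS.eigenvalues_antitone hn) hx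
  · have := OrthonormalBasis.sum_mul_norm_sq_le _ (hT.eigenvalues_antitone hn) hx
    rw [← hT.re_inner_apply_eq_sum hn] at this
    linarith [h x]

/-- **Lidskii's inequality** for the eigenvalues of a sum of symmetric maps. -/
theorem sum_eigenvalues_add_le (hM : M.IsSymmetric) (hN : N.IsSymmetric)
    (hn : Module.finrank 𝕜 E = n) (I : Finset (Fin n)) :
    ∑ i ∈ I, (hM.add hN).eigenvalues hn i ≤
      ∑ i ∈ I, hM.eigenvalues hn i +
        ∑ j with j.val < I.card, hN.eigenvalues hn j := by
  rcases I.eq_empty_or_nonempty with rfl | hI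
  · simp
  have hcard : I.card ≤ n := by simpa using I.card_le_univ
  have hpos : 0 < I.card := hI.card_pos
  set b := hN.eigenvectorBasis hn
  set k : Fin n := ⟨I.card - 1, by omega⟩
  set t := hN.eigenvalues hn k
  set c : Fin n → ℝ := fun j => max (hN.eigenvalues hn j - t) 0
  -- `P` is the positive part of `N - t`
  let P : E →ₗ[𝕜] E := b.diagonalMap c
  have hP : P.IsSymmetric := b.isSymmetric_diagonalMap c
  have hPform (x : E) : RCLike.re (inner 𝕜 x (P x)) = ∑ j, c j * ‖b.repr x j‖ ^ 2 :=
    b.re_inner_apply_of_diagonal (b.repr_diagonalMap c) x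
  have hle (i : Fin n) :
      (hM.add hN).eigenvalues hn i ≤ (hM.add hP).eigenvalues hn i + t := by
    refine eigenvalues_le_add _ _ hn (fun x => ?_) i
    simp only [LinearMap.add_apply, inner_add_right, map_add]
    rw [hPform, hN.re_inner_apply_eq_sum hn, b.norm_sq_eq_sum_repr x, Finset.mul_sum, add_assoc,
      ← Finset.sum_add_distrib]
    gcongr with j
    rw [← add_mul]
    gcongr
    linarith [le_max_left (hN.eigenvalues hn j - t) 0]
  have hge (i : Fin n) : hM.eigenvalues hn i ≤ (hM.add hP).eigenvalues hn i := by
    have := eigenvalues_le_add hM (hM.add hP) hn (t := 0) (fun x => ?_) i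
    · simpa using this
    simp only [LinearMap.add_apply, inner_add_right, map_add]
    have : 0 ≤ ∑ j, c j * ‖b.repr x j‖ ^ 2 :=
      Finset.sum_nonneg fun j _ => mul_nonneg (le_max_right _ _) (by positivity)
    linarith [hPform x]
  have htrace : ∑ i, (hM.add hP).eigenvalues hn i = ∑ i, hM.eigenvalues hn i + ∑ j, c j := by
    rw [← re_trace_eq_sum_eigenvalues, ← re_trace_eq_sum_eigenvalues, map_add, map_add,
      P.trace_eq_sum_inner b]
    simp [P, b.diagonalMap_apply_self, inner_smul_right]
  have hsum : ∑ j, c j = ∑ j with j.val < I.card, hN.eigenvalues hn j - I.card * t := by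
    have hcount : (Finset.univ.filter fun j : Fin n => j.val < I.card).card = I.card := by
      rw [Fin.card_filter_val_lt, min_eq_right hcard]
    have : (I.card : ℝ) * t = ∑ j : Fin n with j.val < I.card, t := by
      rw [Finset.sum_const, hcount, nsmul_eq_mul]
    rw [this, ← Finset.sum_sub_distrib, Finset.sum_filter]
    refine Finset.sum_congr rfl fun j _ => ?_
    split_ifs with hj
    · refine max_eq_left (sub_nonneg.mpr (hN.eigenvalues_antitone hn ?_))
      rw [Fin.le_def]; simp only [k]; omega
    · refine max_eq_right (sub_nonpos.mpr (hN.eigenvalues_antitone hn ?_))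
      rw [Fin.le_def]; simp only [k]; omega
  have h₁ : ∑ i ∈ I, (hM.add hN).eigenvalues hn i ≤
      ∑ i ∈ I, (hM.add hP).eigenvalues hn i + I.card * t := by
    calc _ ≤ ∑ i ∈ I, ((hM.add hP).eigenvalues hn i + t) := Finset.sum_le_sum fun i _ => hle i
      _ = _ := by rw [Finset.sum_add_distrib, Finset.sum_const, nsmul_eq_mul]
  have h₂ : ∑ i ∈ I, ((hM.add hP).eigenvalues hn i - hM.eigenvalues hn i) ≤
      ∑ i, ((hM.add hP).eigenvalues hn i - hM.eigenvalues hn i) :=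
    Finset.sum_le_univ_sum_of_nonneg fun i => sub_nonneg.mpr (hge i)
  rw [Finset.sum_sub_distrib, Finset.sum_sub_distrib] at h₂
  linarith

end LinearMap.IsSymmetric

end Eigenvalues

section SingularValues

variable {𝕜 : Type*} [RCLike 𝕜] {n : ℕ}
  {E : Type*} [NormedAddCommGroup E] [InnerProductSpace 𝕜 E] [FiniteDimensional 𝕜 E]
  {F : Type*} [NormedAddCommGroup F] [InnerProductSpace 𝕜 F] [FiniteDimensional 𝕜 F]

namespace LinearMap

/-- The symmetric part of `W† ∘ T`. -/
noncomputable def symmPart (W T : E →ₗ[𝕜] F) : E →ₗ[𝕜] E :=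
  (2⁻¹ : 𝕜) • (adjoint W ∘ₗ T + adjoint T ∘ₗ W)

lemma isSymmetric_symmPart (W T : E →ₗ[𝕜] F) : (symmPart W T).IsSymmetric := by
  intro x y
  simp only [symmPart, smul_apply, add_apply, comp_apply, inner_smul_left, inner_smul_right,
    inner_add_left, inner_add_right, adjoint_inner_left, adjoint_inner_right, map_inv₀, map_ofNat]
  ring

lemma symmPart_add (W S T : E →ₗ[𝕜] F) : symmPart W (S + T) = symmPart W S + symmPart W T := by
  simp only [symmPart, map_add, comp_add, add_comp, ← smul_add]
  congr 1
  abel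

lemma re_inner_symmPart (W T : E →ₗ[𝕜] F) (x : E) :
    RCLike.re (inner 𝕜 x (symmPart W T x)) = RCLike.re (inner 𝕜 (W x) (T x)) := by
  have h : RCLike.re (inner 𝕜 (T x) (W x)) = RCLike.re (inner 𝕜 (W x) (T x)) :=
    inner_re_symm _ _
  have h2 : (2⁻¹ : 𝕜) = ((2⁻¹ : ℝ) : 𝕜) := by rw [RCLike.ofReal_inv, RCLike.ofReal_ofNat]
  simp only [symmPart, smul_apply, add_apply, comp_apply, inner_smul_right, inner_add_right,
    adjoint_inner_right]
  rw [h2, RCLike.re_ofReal_mul, map_add, h]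
  ring

/-- The right singular vectors of a linear map. -/
noncomputable def rightSingularBasis (T : E →ₗ[𝕜] F) (hn : Module.finrank 𝕜 E = n) :
    OrthonormalBasis (Fin n) 𝕜 E :=
  T.isSymmetric_adjoint_comp_self.eigenvectorBasis hn

lemma norm_sq_apply_eq_sum (T : E →ₗ[𝕜] F) (hn : Module.finrank 𝕜 E = n) (x : E) :
    ‖T x‖ ^ 2 = ∑ j : Fin n, T.singularValues j ^ 2 * ‖(T.rightSingularBasis hn).repr x j‖ ^ 2 := by
  simp_rw [T.sq_singularValues_fin hn]
  rw [rightSingularBasis, ← T.isSymmetric_adjoint_comp_self.re_inner_apply_eq_sum hn, comp_apply,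
    adjoint_inner_right, inner_self_eq_norm_sq]

/-- The partial isometry of the polar decomposition. -/
lemma exists_contraction_re_inner_eq_sum (T : E →ₗ[𝕜] F) (hn : Module.finrank 𝕜 E = n) :
    ∃ W : E →ₗ[𝕜] F, (∀ x, ‖W x‖ ≤ ‖x‖) ∧ ∀ x, RCLike.re (inner 𝕜 (W x) (T x)) =
      ∑ j : Fin n, T.singularValues j * ‖(T.rightSingularBasis hn).repr x j‖ ^ 2 := by
  set b := T.rightSingularBasis hn with hb
  let R : E →ₗ[𝕜] E := b.diagonalMap fun j => (T.singularValues j)⁻¹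
  have hRrepr (x : E) (j : Fin n) :
      b.repr (R x) j = (((T.singularValues j)⁻¹ : ℝ) : 𝕜) * b.repr x j :=
    b.repr_diagonalMap _ x j
  have hTrepr (x : E) (j : Fin n) :
      b.repr (adjoint T (T x)) j = ((T.singularValues j ^ 2 : ℝ) : 𝕜) * b.repr x j := by
    rw [T.sq_singularValues_fin hn]
    exact T.isSymmetric_adjoint_comp_self.eigenvectorBasis_apply_self_apply hn x j
  refine ⟨T ∘ₗ R, fun x => ?_, fun x => ?_⟩
  · refine le_of_sq_le_sq ?_ (norm_nonneg x)
    rw [comp_apply, T.norm_sq_apply_eq_sum hn, ← hb, b.norm_sq_eq_sum_repr x]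
    refine Finset.sum_le_sum fun j _ => ?_
    rw [hRrepr, norm_mul, RCLike.norm_ofReal, mul_pow, sq_abs, ← mul_assoc, ← mul_pow]
    rcases eq_or_ne (T.singularValues j) 0 with h | h
    · simp [h]
    · simp [h]
  · rw [comp_apply, ← adjoint_inner_right, ← b.repr.inner_map_map, PiLp.inner_apply, map_sum]
    refine Finset.sum_congr rfl fun j _ => ?_
    rw [hRrepr, hTrepr, RCLike.inner_apply, map_mul (starRingEnd 𝕜), RCLike.conj_ofReal, mul_mul_mul_comm,
      RCLike.mul_conj, ← RCLike.ofReal_pow, ← RCLike.ofReal_mul, ← RCLike.ofReal_mul,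
      RCLike.ofReal_re]
    rcases eq_or_ne (T.singularValues j) 0 with h | h
    · simp [h]
    · field_simp

lemma antitone_singularValues_fin (T : E →ₗ[𝕜] F) :
    Antitone fun j : Fin n => T.singularValues j :=
  fun _ _ h => T.singularValues_antitone h

/-- The **Fan–Hoffman inequality**, with a contraction inserted. -/
lemma eigenvalues_symmPart_le (W T : E →ₗ[𝕜] F) (hn : Module.finrank 𝕜 E = n)
    (hW : ∀ x, ‖W x‖ ≤ ‖x‖) (i : Fin n) :
    (isSymmetric_symmPart W T).eigenvalues hn i ≤ T.singularValues i := by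
  have hH := isSymmetric_symmPart W T
  refine (hH.eigenvectorBasis hn).le_of_forall_le (T.rightSingularBasis hn) i
    (Q := fun x => RCLike.re (inner 𝕜 x (symmPart W T x))) (fun x hx => ?_) (fun x hx => ?_)
  · rw [hH.re_inner_apply_eq_sum hn]
    exact OrthonormalBasis.le_sum_mul_norm_sq _ (hH.eigenvalues_antitone hn) hx
  · have hT : ‖T x‖ ≤ T.singularValues i * ‖x‖ := by
      refine le_of_sq_le_sq ?_ (mul_nonneg (T.singularValues_nonneg i) (norm_nonneg x))
      rw [T.norm_sq_apply_eq_sum hn, mul_pow]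
      exact OrthonormalBasis.sum_mul_norm_sq_le (c := fun j => T.singularValues j ^ 2) _
        (fun j k h => pow_le_pow_left₀ (T.singularValues_nonneg _)
          (T.antitone_singularValues_fin h) 2) hx
    calc RCLike.re (inner 𝕜 x (symmPart W T x))
        = RCLike.re (inner 𝕜 (W x) (T x)) := re_inner_symmPart W T x
      _ ≤ ‖W x‖ * ‖T x‖ := re_inner_le_norm _ _
      _ ≤ ‖x‖ * (T.singularValues i * ‖x‖) :=
        mul_le_mul (hW x) hT (norm_nonneg _) (norm_nonneg _)
      _ = T.singularValues i * ‖x‖ ^ 2 := by ring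

/-- **Lidskii's inequality** for the singular values of a sum of linear maps. -/
theorem sum_singularValues_add_le (A B : E →ₗ[𝕜] F) (hn : Module.finrank 𝕜 E = n)
    (I : Finset (Fin n)) :
    ∑ i ∈ I, (A + B).singularValues i ≤
      ∑ i ∈ I, B.singularValues i + ∑ j : Fin n with j.val < I.card, A.singularValues j := by
  obtain ⟨W, hW, hWform⟩ := (A + B).exists_contraction_re_inner_eq_sum hn
  have hA := isSymmetric_symmPart W A
  have hB := isSymmetric_symmPart W B
  have hle (i : Fin n) : (A + B).singularValues i ≤ (hB.add hA).eigenvalues hn i := by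
    refine ((A + B).rightSingularBasis hn).le_of_forall_le ((hB.add hA).eigenvectorBasis hn) i
      (Q := fun x => RCLike.re (inner 𝕜 (W x) ((A + B) x))) (fun x hx => ?_) (fun x hx => ?_)
    · rw [hWform]
      exact OrthonormalBasis.le_sum_mul_norm_sq _ (A + B).antitone_singularValues_fin hx
    · rw [← re_inner_symmPart, add_comm A B, symmPart_add, (hB.add hA).re_inner_apply_eq_sum hn]
      exact OrthonormalBasis.sum_mul_norm_sq_le _ ((hB.add hA).eigenvalues_antitone hn) hx
  calc ∑ i ∈ I, (A + B).singularValues i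
      ≤ ∑ i ∈ I, (hB.add hA).eigenvalues hn i := Finset.sum_le_sum fun i _ => hle i
    _ ≤ ∑ i ∈ I, hB.eigenvalues hn i + ∑ j : Fin n with j.val < I.card, hA.eigenvalues hn j :=
      hB.sum_eigenvalues_add_le hA hn I
    _ ≤ _ := add_le_add (Finset.sum_le_sum fun i _ => eigenvalues_symmPart_le W B hn hW i)
      (Finset.sum_le_sum fun i _ => eigenvalues_symmPart_le W A hn hW i)

end LinearMap

end SingularValues

lemma eigsDesc_eq_eigenvalues₀ {n : ℕ} {A : Matrix (Fin n) (Fin n) ℂ} (hA : A.IsHermitian)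
    (i : Fin n) : eigsDesc hA i = hA.eigenvalues₀ (Fin.cast (Fintype.card_fin n).symm i) := by
  let e : Fin n ≃ Fin (Fintype.card (Fin n)) := finCongr (Fintype.card_fin n).symm
  let σ : Equiv.Perm (Fin n) :=
    e.trans (Fintype.equivOfCardEq (Fintype.card_fin (Fintype.card (Fin n))))
  have hσ : hA.eigenvalues ∘ σ = hA.eigenvalues₀ ∘ e := by
    ext j
    simp [σ, Matrix.IsHermitian.eigenvalues]
  have hanti : Antitone (hA.eigenvalues ∘ σ) := by
    rw [hσ]
    exact fun j k h => hA.eigenvalues₀_antitone h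
  have hanti' : Antitone (hA.eigenvalues ∘ (Fin.revPerm.trans (Tuple.sort hA.eigenvalues))) :=
    fun j k h => Tuple.monotone_sort hA.eigenvalues (Fin.rev_le_rev.mpr h)
  have := congrFun (Tuple.unique_antitone hanti' hanti) i
  rw [hσ] at this
  exact this

lemma sval_eq_singularValues {p q : ℕ} (A : Matrix (Fin p) (Fin q) ℂ) (k : ℕ) :
    sval A k = (Matrix.toEuclideanLin A).singularValues (k - 1) := by
  have hn : Module.finrank ℂ (EuclideanSpace ℂ (Fin q)) = Fintype.card (Fin q) :=
    finrank_euclideanSpace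
  unfold sval
  split_ifs with h
  · have hT : Matrix.toEuclideanLin (Aᴴ * A) =
        LinearMap.adjoint (Matrix.toEuclideanLin A) ∘ₗ Matrix.toEuclideanLin A := by
      rw [← Matrix.toEuclideanLin_conjTranspose_eq_adjoint]
      exact Matrix.toLpLin_mul_same 2 _ _
    rw [LinearMap.singularValues_of_lt _ hn (by simpa using h), singularValues,
      eigsDesc_eq_eigenvalues₀]
    simp only [Matrix.IsHermitian.eigenvalues₀, hT]
    rfl
  · rw [LinearMap.singularValues_of_finrank_le _ (by simpa using h)]

/-- **Lidskii inequality for singular values.**  For `p ≥ q ≥ 1`, complex `p × q` matrices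
`A`, `B`, and any subset `{i_1 < … < i_r}` of `[q]` (encoded by a strictly monotone map
`ι : Fin r → ℕ` with values in `[q]`), one has
`∑_{k=1}^r τ_{i_k}(A+B) ≤ ∑_{k=1}^r τ_{i_k}(B) + ∑_{k=1}^r τ_k(A)`. -/
theorem lidskii_inequality_singular_values (p q r : ℕ) (hq : 1 ≤ q) (hpq : q ≤ p)
    (A B : Matrix (Fin p) (Fin q) ℂ)
    (ι : Fin r → ℕ) (hmono : StrictMono ι) (hrange : ∀ k, 1 ≤ ι k ∧ ι k ≤ q) :
    ∑ k, sval (A + B) (ι k) ≤ ∑ k, sval B (ι k) + ∑ k : Fin r, sval A (k.val + 1) := by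
  have hlt (k : Fin r) : ι k - 1 < q := by have := hrange k; omega
  let f : Fin r → Fin q := fun k => ⟨ι k - 1, hlt k⟩
  have hf : Function.Injective f := by
    intro k l h
    have hkl : ι k - 1 = ι l - 1 := congrArg Fin.val h
    have := hrange k
    have := hrange l
    exact hmono.injective (by omega)
  have hr : r ≤ q := by simpa using Fintype.card_le_of_injective f hf
  have hn : Module.finrank ℂ (EuclideanSpace ℂ (Fin q)) = q := by simp
  have key := LinearMap.sum_singularValues_add_le (Matrix.toEuclideanLin A)
    (Matrix.toEuclideanLin B) hn (Finset.univ.map ⟨f, hf⟩)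
  have hA : ∑ j : Fin q with j.val < r, (Matrix.toEuclideanLin A).singularValues j =
      ∑ k : Fin r, (Matrix.toEuclideanLin A).singularValues k := by
    symm
    refine Finset.sum_nbij (Fin.castLE hr) (by simp) (Fin.castLE_injective hr).injOn ?_ (by simp)
    intro j hj
    exact ⟨⟨j, by simpa using hj⟩, by simp, rfl⟩
  simp only [Finset.card_map, Finset.card_univ, Fintype.card_fin, Finset.sum_map,
    Function.Embedding.coeFn_mk, hA, f] at key
  simpa only [sval_eq_singularValues, map_add, Nat.add_sub_cancel] using key
end

section
/- Let p ≥ q ≥ 1 and let A, B be complex p×q matrices. For any subsets {i_1 < … < i_r} and {j_1 < … < j_r} of [q] satisfying i_r + j_r − r ≤ q, the Thompson inequality ∑_{α=1}^r τ_{i_α + j_α − α}(A+B) ≤ ∑_{α=1}^r τ_{i_α}(A) + ∑_{α=1}^r τ_{j_α}(B) holds. -/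
open Matrix

open Module

theorem Submodule.map_inf_comap_eq {K V W : Type*} [Ring K] [AddCommGroup V] [Module K V]
    [AddCommGroup W] [Module K W] (f : V →ₗ[K] W) (P : Submodule K V) (S : Submodule K W) :
    (P ⊓ S.comap f).map f = P.map f ⊓ S :=
  SetLike.coe_injective (Set.image_inter_preimage f P S)

section Flags

variable {K V : Type*} [Field K] [AddCommGroup V] [Module K V] [FiniteDimensional K V]

theorem Submodule.finrank_comap_mkQ_span_singleton_inf {v : V} (hv : v ≠ 0) (P : Submodule K V)
    (S : Submodule K (V ⧸ K ∙ v)) [Decidable (v ∈ P)] :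
    finrank K (S.comap (K ∙ v).mkQ ⊓ P : Submodule K V) =
      finrank K (S ⊓ P.map (K ∙ v).mkQ : Submodule K (V ⧸ K ∙ v)) + if v ∈ P then 1 else 0 := by
  set f := (K ∙ v).mkQ with hf
  set T := S.comap f ⊓ P with hT
  have hmap : T.map f = S ⊓ P.map f := by
    rw [hT, inf_comm, Submodule.map_inf_comap_eq, inf_comm]
  have hvS : v ∈ S.comap f := by
    have : f v = 0 := by simp [hf]
    simp [Submodule.mem_comap, this]
  rw [← hmap, ← (f.domRestrict T).finrank_range_add_finrank_ker, LinearMap.range_domRestrict,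
    LinearMap.ker_domRestrict, ← Submodule.finrank_map_subtype_eq T,
    Submodule.map_comap_subtype, hf, Submodule.ker_mkQ]
  congr 1
  split_ifs with h
  · have : T ⊓ K ∙ v = K ∙ v := by
      rw [inf_eq_right, Submodule.span_singleton_le_iff_mem]
      exact ⟨hvS, h⟩
    rw [this, finrank_span_singleton hv]
  · have : T ⊓ K ∙ v = ⊥ := by
      rw [← disjoint_iff, Submodule.disjoint_span_singleton' hv]
      exact fun h' => h h'.2
    rw [this, finrank_bot]

omit [FiniteDimensional K V] in
theorem Submodule.exists_forall_eq_top_or_notMem {N : ℕ → Submodule K V} (hN : Antitone N) :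
    ∃ u : V, ∀ α, N α = ⊤ ∨ u ∉ N α := by
  classical
  by_cases h : ∃ m, N m ≠ ⊤
  · obtain ⟨u, hu⟩ : ∃ u, u ∉ N (Nat.find h) := by
      by_contra! hu
      exact Nat.find_spec h (Submodule.eq_top_iff'.2 hu)
    refine ⟨u, fun α => ?_⟩
    rcases lt_or_ge α (Nat.find h) with hα | hα
    · exact Or.inl (not_not.1 (Nat.find_min h hα))
    · exact Or.inr fun h' => hu (hN hα h')
  · push Not at h
    exact ⟨0, fun α => Or.inl (h α)⟩

theorem Submodule.finrank_eq_finrank_map_mkQ_add {v : V} (hv : v ≠ 0) (P : Submodule K V)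
    [Decidable (v ∈ P)] :
    finrank K P = finrank K (P.map (K ∙ v).mkQ) + if v ∈ P then 1 else 0 := by
  have := Submodule.finrank_comap_mkQ_span_singleton_inf hv P ⊤
  rwa [Submodule.comap_top, top_inf_eq, top_inf_eq] at this

theorem Submodule.exists_antitone_quotient {v : V} (hv : v ≠ 0) {N : ℕ → Submodule K V}
    (hN : Antitone N) :
    ∃ N' : ℕ → Submodule K (V ⧸ K ∙ v), Antitone N' ∧ ∀ α,
      (finrank K (N' α) + 1 = finrank K V ∨ finrank K (N α) ≤ finrank K (N' α)) ∧
      ∀ S : Submodule K (V ⧸ K ∙ v), finrank K (S ⊓ N' α : Submodule K (V ⧸ K ∙ v)) ≤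
        finrank K (S.comap (K ∙ v).mkQ ⊓ N α : Submodule K V) := by
  classical
  have hmono : Antitone fun α => (N α).map (K ∙ v).mkQ := fun _ _ h => Submodule.map_mono (hN h)
  have hdim := fun α => Submodule.finrank_eq_finrank_map_mkQ_add hv (N α)
  have hV := Submodule.finrank_eq_finrank_map_mkQ_add hv (⊤ : Submodule K V)
  rw [if_pos Submodule.mem_top, finrank_top, Submodule.map_top, Submodule.range_mkQ, finrank_top] at hV
  obtain ⟨u, hu⟩ := Submodule.exists_forall_eq_top_or_notMem hmono
  obtain ⟨N', hpos, hneg⟩ : ∃ N' : ℕ → Submodule K (V ⧸ K ∙ v),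
      (∀ α, v ∈ N α → N' α = (N α).map (K ∙ v).mkQ ⊔ K ∙ u) ∧
      ∀ α, v ∉ N α → N' α = (N α).map (K ∙ v).mkQ :=
    ⟨fun α => if v ∈ N α then (N α).map (K ∙ v).mkQ ⊔ K ∙ u else (N α).map (K ∙ v).mkQ,
      fun _ h => if_pos h, fun _ h => if_neg h⟩
  refine ⟨N', fun α β h => ?_, fun α => ?_⟩
  · by_cases hβ : v ∈ N β
    · rw [hpos β hβ, hpos α (hN h hβ)]
      exact sup_le_sup_right (hmono h) _
    · rw [hneg β hβ]
      by_cases hα : v ∈ N α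
      · rw [hpos α hα]
        exact (hmono h).trans le_sup_left
      · rw [hneg α hα]
        exact hmono h
  · have hS := Submodule.finrank_comap_mkQ_span_singleton_inf hv (N α)
    specialize hdim α
    by_cases hα : v ∈ N α
    · rw [if_pos hα] at hdim
      rw [hpos α hα]
      constructor
      · rcases hu α with h | h
        · left
          rw [h, top_sup_eq, finrank_top, hV]
        · right
          rw [Submodule.finrank_sup_span_singleton h, hdim]
      · intro S
        rw [hS, if_pos hα]
        set P := (N α).map (K ∙ v).mkQ
        have h1 := Submodule.finrank_sup_add_finrank_inf_eq (S ⊓ (P ⊔ K ∙ u)) P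
        have h2 : S ⊓ (P ⊔ K ∙ u) ⊓ P = S ⊓ P := by
          rw [inf_assoc, inf_eq_right.2 (le_sup_left : P ≤ P ⊔ K ∙ u)]
        have h3 : finrank K (S ⊓ (P ⊔ K ∙ u) ⊔ P : Submodule K (V ⧸ K ∙ v)) ≤
            finrank K (P ⊔ K ∙ u : Submodule K (V ⧸ K ∙ v)) :=
          Submodule.finrank_mono (sup_le inf_le_right le_sup_left)
        have h4 := Submodule.finrank_add_le_finrank_add_finrank P (K ∙ u)
        have h5 : finrank K (K ∙ u) ≤ 1 := (finrank_span_le_card {u}).trans (by simp)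
        rw [h2] at h1
        omega
    · rw [if_neg hα] at hdim
      rw [hneg α hα]
      exact ⟨Or.inr (by omega), fun S => by rw [hS, if_neg hα]; omega⟩

end Flags

theorem Submodule.exists_finrank_inf_flags {K : Type*} [Field K] (r : ℕ) :
    ∀ {V : Type*} [AddCommGroup V] [Module K V] [FiniteDimensional K V]
      {M N L : ℕ → Submodule K V} {a b : ℕ → ℕ}
      (_ : Monotone M) (_ : Antitone N) (_ : Antitone L) (_ : Monotone a) (_ : Monotone b)
      (_ : ∀ α < r, α + 1 + a α + b α ≤ finrank K (M α))
      (_ : ∀ α < r, finrank K V ≤ finrank K (N α) + α + a α)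
      (_ : ∀ α < r, finrank K V ≤ finrank K (L α) + α + b α),
      ∃ S : Submodule K V, finrank K S = r ∧ ∀ α < r,
        α + 1 ≤ finrank K (S ⊓ M α : Submodule K V) ∧
        r ≤ α + finrank K (S ⊓ N α : Submodule K V) ∧
        r ≤ α + finrank K (S ⊓ L α : Submodule K V) := by
  induction r with
  | zero => exact fun _ _ _ _ _ _ _ _ => ⟨⊥, by simp, by simp⟩
  | succ r ih =>
    intro V _ _ _ M N L a b hM hN hL ha hb hMd hNd hLd
    classical
    set W := N 0 ⊓ L 0 with hW
    have hWd := Submodule.finrank_sup_add_finrank_inf_eq (N 0) (L 0)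
    rw [← hW] at hWd
    have hN0 := Submodule.finrank_le (N 0)
    have hL0 := Submodule.finrank_le (L 0)
    have hNL := Submodule.finrank_le (N 0 ⊔ L 0)
    have hMW : ∀ α, finrank K (M α) + finrank K W ≤
        finrank K V + finrank K (W ⊓ M α : Submodule K V) := fun α => by
      have h1 := Submodule.finrank_sup_add_finrank_inf_eq W (M α)
      have h2 := Submodule.finrank_le (W ⊔ M α)
      omega
    have hNW : ∀ α, finrank K (N α) + finrank K W ≤
        finrank K (N 0) + finrank K (W ⊓ N α : Submodule K V) := fun α => by
      have h1 := Submodule.finrank_sup_add_finrank_inf_eq W (N α)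
      have h2 := Submodule.finrank_mono (sup_le inf_le_left (hN (Nat.zero_le α)) : W ⊔ N α ≤ N 0)
      omega
    have hLW : ∀ α, finrank K (L α) + finrank K W ≤
        finrank K (L 0) + finrank K (W ⊓ L α : Submodule K V) := fun α => by
      have h1 := Submodule.finrank_sup_add_finrank_inf_eq W (L α)
      have h2 := Submodule.finrank_mono (sup_le inf_le_right (hL (Nat.zero_le α)) : W ⊔ L α ≤ L 0)
      omega
    have hcomap : ∀ P : Submodule K V,
        finrank K (P.comap W.subtype) = finrank K (W ⊓ P : Submodule K V) := fun P => by
      rw [← Submodule.finrank_map_subtype_eq W, Submodule.map_comap_subtype]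
    have h0 := hMd 0 (by omega)
    have h0N := hNd 0 (by omega)
    have h0L := hLd 0 (by omega)
    obtain ⟨v, hvM, hv⟩ : ∃ v ∈ (M 0).comap W.subtype, v ≠ 0 := by
      refine Submodule.exists_mem_ne_zero_of_ne_bot fun h => ?_
      have h1 := hcomap (M 0)
      have h2 := hMW 0
      rw [h, finrank_bot] at h1
      omega
    obtain ⟨N', hN', hN's⟩ := Submodule.exists_antitone_quotient hv
      (N := fun α => (N (α + 1)).comap W.subtype)
      (fun _ _ h => Submodule.comap_mono (hN (Nat.succ_le_succ h)))
    obtain ⟨L', hL', hL's⟩ := Submodule.exists_antitone_quotient hv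
      (N := fun α => (L (α + 1)).comap W.subtype)
      (fun _ _ h => Submodule.comap_mono (hL (Nat.succ_le_succ h)))
    have hfin := fun (P : Submodule K W) (S : Submodule K (W ⧸ K ∙ v)) (hP : v ∈ P) =>
      (Submodule.finrank_comap_mkQ_span_singleton_inf hv P S).trans (by rw [if_pos hP])
    have hQ := Submodule.finrank_eq_finrank_map_mkQ_add hv (⊤ : Submodule K W)
    rw [if_pos Submodule.mem_top, finrank_top, Submodule.map_top, Submodule.range_mkQ, finrank_top] at hQ
    have hM1 := fun α => Submodule.finrank_eq_finrank_map_mkQ_add hv ((M α).comap W.subtype)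
    simp only [hcomap, fun α => Submodule.comap_mono (hM (Nat.zero_le α)) hvM, if_true] at hM1
    obtain ⟨S', hS', hS's⟩ := ih (V := W ⧸ K ∙ v)
      (M := fun α => ((M (α + 1)).comap W.subtype).map (K ∙ v).mkQ) (N := N') (L := L')
      (a := fun α => a (α + 1) - (finrank K V - finrank K (N 0)))
      (b := fun α => b (α + 1) - (finrank K V - finrank K (L 0)))
      (fun _ _ h => Submodule.map_mono (Submodule.comap_mono (hM (Nat.succ_le_succ h)))) hN' hL'
      (fun _ _ h => Nat.sub_le_sub_right (ha (Nat.succ_le_succ h)) _)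
      (fun _ _ h => Nat.sub_le_sub_right (hb (Nat.succ_le_succ h)) _)
      (fun α hα => by
        have h1 := hM1 (α + 1)
        have h2 := hMd (α + 1) (by omega)
        have h3 := hMW (α + 1)
        have h4 := ha (Nat.zero_le (α + 1))
        have h5 := hb (Nat.zero_le (α + 1))
        omega)
      (fun α hα => by
        have h1 := (hN's α).1
        rw [hcomap] at h1
        have h2 := hNd (α + 1) (by omega)
        have h3 := hNW (α + 1)
        have h4 := ha (Nat.zero_le (α + 1))
        omega)
      (fun α hα => by
        have h1 := (hL's α).1
        rw [hcomap] at h1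
        have h2 := hLd (α + 1) (by omega)
        have h3 := hLW (α + 1)
        have h4 := hb (Nat.zero_le (α + 1))
        omega)
    set T := S'.comap (K ∙ v).mkQ with hT
    have hvT : v ∈ T := by
      have : (K ∙ v).mkQ v = 0 := by simp
      simp [hT, Submodule.mem_comap, this]
    have hinf : ∀ P : Submodule K V, finrank K (T.map W.subtype ⊓ P : Submodule K V) =
        finrank K (T ⊓ P.comap W.subtype : Submodule K W) := fun P => by
      rw [← Submodule.map_inf_comap_eq, Submodule.finrank_map_subtype_eq]
    have hTd : finrank K T = r + 1 := by
      have := hfin ⊤ S' trivial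
      rwa [inf_top_eq, Submodule.map_top, Submodule.range_mkQ, inf_top_eq, hS'] at this
    have hTW : T.map W.subtype ≤ W := Submodule.map_subtype_le W T
    refine ⟨T.map W.subtype, by rw [Submodule.finrank_map_subtype_eq, hTd], fun α hα => ?_⟩
    rcases α with _ | α
    · refine ⟨?_, ?_, ?_⟩
      · rw [hinf, zero_add, Nat.one_le_iff_ne_zero, Ne, Submodule.finrank_eq_zero]
        exact fun h => hv ((Submodule.mem_bot K).1 (h ▸ ⟨hvT, hvM⟩))
      · rw [inf_eq_left.2 (hTW.trans inf_le_left), Submodule.finrank_map_subtype_eq, hTd, zero_add]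
      · rw [inf_eq_left.2 (hTW.trans inf_le_right), Submodule.finrank_map_subtype_eq, hTd, zero_add]
    · obtain ⟨h1, h2, h3⟩ := hS's α (by omega)
      have h4 := (hN's α).2 S'
      have h5 := (hL's α).2 S'
      have h6 := hfin ((M (α + 1)).comap W.subtype) S'
        (Submodule.comap_mono (hM (Nat.zero_le (α + 1))) hvM)
      rw [← hT] at h4 h5 h6
      simp only [hinf]
      refine ⟨?_, ?_, ?_⟩ <;> omega

theorem exists_orthonormal_forall_mem {H : Type*} [NormedAddCommGroup H] [InnerProductSpace ℂ H]
    [FiniteDimensional ℂ H] {r : ℕ} (P : Fin r → Submodule ℂ H)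
    (hP : ∀ α, α.val + 1 ≤ finrank ℂ (P α)) :
    ∃ x : Fin r → H, Orthonormal ℂ x ∧ ∀ α, x α ∈ P α := by
  induction r with
  | zero => exact ⟨Fin.elim0, ⟨fun α => α.elim0, fun α => α.elim0⟩, fun α => α.elim0⟩
  | succ r ih =>
    obtain ⟨x, hx, hxP⟩ := ih (fun α => P α.castSucc) fun α => hP α.castSucc
    obtain ⟨e, ⟨heP, hex⟩, he⟩ : ∃ e ∈ P (Fin.last r) ⊓ (Submodule.span ℂ (Set.range x))ᗮ,
        e ≠ 0 := by
      refine Submodule.exists_mem_ne_zero_of_ne_bot fun h => ?_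
      have h1 := Submodule.finrank_sup_add_finrank_inf_eq (P (Fin.last r))
        (Submodule.span ℂ (Set.range x))ᗮ
      have h2 := Submodule.finrank_add_finrank_orthogonal (Submodule.span ℂ (Set.range x))
      have h3 := Submodule.finrank_le (P (Fin.last r) ⊔ (Submodule.span ℂ (Set.range x))ᗮ)
      have h4 := hP (Fin.last r)
      rw [finrank_span_eq_card hx.linearIndependent, Fintype.card_fin] at h2
      rw [h, finrank_bot] at h1
      simp only [Fin.val_last] at h4
      omega
    have hxe : ∀ α, inner ℂ (x α) e = 0 := fun α =>
      (Submodule.mem_orthogonal _ e).1 hex _ (Submodule.subset_span ⟨α, rfl⟩)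
    have hn : (‖e‖ : ℂ) ≠ 0 := by simpa using he
    refine ⟨Fin.snoc x ((‖e‖ : ℂ)⁻¹ • e), ⟨fun α => ?_, fun α β hαβ => ?_⟩, fun α => ?_⟩
    · induction α using Fin.lastCases with
      | last => simp [norm_smul, he]
      | cast α => simpa using hx.1 α
    · induction α using Fin.lastCases with
      | last =>
        induction β using Fin.lastCases with
        | last => exact absurd rfl hαβ
        | cast β =>
          simp [inner_smul_left, inner_eq_zero_symm.1 (hxe β)]
      | cast α =>
        induction β using Fin.lastCases with
        | last => simp [inner_smul_right, hxe α]
        | cast β => simpa using hx.2 fun h => hαβ (congrArg _ h)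
    · induction α using Fin.lastCases with
      | last => simpa using (P (Fin.last r)).smul_mem _ heP
      | cast α => simpa using hxP α

theorem Orthonormal.sum_inner_apply_eq_trace {H : Type*} [NormedAddCommGroup H]
    [InnerProductSpace ℂ H] [FiniteDimensional ℂ H] {ι : Type*} [Fintype ι]
    {S : Submodule ℂ H} (hS : finrank ℂ S = Fintype.card ι) {x : ι → H} (hx : Orthonormal ℂ x)
    (hxS : ∀ α, x α ∈ S) (T : H →ₗ[ℂ] H) :
    ∑ α, inner ℂ (x α) (T (x α)) =
      LinearMap.trace ℂ S (S.orthogonalProjectionOnto.toLinearMap ∘ₗ T ∘ₗ S.subtype) := by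
  have hx' : Orthonormal ℂ fun α => (⟨x α, hxS α⟩ : S) := by
    rw [← S.subtypeₗᵢ.orthonormal_comp_iff]
    exact hx
  have hb : ⊤ ≤ Submodule.span ℂ (Set.range fun α => (⟨x α, hxS α⟩ : S)) :=
    (hx'.linearIndependent.span_eq_top_of_card_eq_finrank' hS.symm).ge
  rw [LinearMap.trace_eq_sum_inner _ (OrthonormalBasis.mk hx' hb)]
  refine Finset.sum_congr rfl fun α _ => ?_
  simp

theorem sum_le_sum_add_sum_of_flags {H : Type*} [NormedAddCommGroup H]
    [InnerProductSpace ℂ H] [FiniteDimensional ℂ H] {r : ℕ} {S : Submodule ℂ H}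
    (hS : finrank ℂ S = r) (T₁ T₂ : H →ₗ[ℂ] H) {M N L : Fin r → Submodule ℂ H}
    (hM : ∀ α, α.val + 1 ≤ finrank ℂ (S ⊓ M α : Submodule ℂ H))
    (hN : ∀ α, r ≤ α.val + finrank ℂ (S ⊓ N α : Submodule ℂ H))
    (hL : ∀ α, r ≤ α.val + finrank ℂ (S ⊓ L α : Submodule ℂ H))
    {a b c : Fin r → ℝ}
    (hc : ∀ α, ∀ x ∈ M α, c α * ‖x‖ ^ 2 ≤ (inner ℂ x ((T₁ + T₂) x)).re)
    (ha : ∀ α, ∀ x ∈ N α, (inner ℂ x (T₁ x)).re ≤ a α * ‖x‖ ^ 2)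
    (hb : ∀ α, ∀ x ∈ L α, (inner ℂ x (T₂ x)).re ≤ b α * ‖x‖ ^ 2) :
    ∑ α, c α ≤ ∑ α, a α + ∑ α, b α := by
  have hS' : finrank ℂ S = Fintype.card (Fin r) := by rw [hS, Fintype.card_fin]
  obtain ⟨x, hx, hxM⟩ := exists_orthonormal_forall_mem _ hM
  obtain ⟨y, hy, hyN⟩ := exists_orthonormal_forall_mem (fun α : Fin r => S ⊓ N α.rev) fun α => by
    have := hN α.rev
    rw [Fin.val_rev] at this
    omega
  obtain ⟨z, hz, hzL⟩ := exists_orthonormal_forall_mem (fun α : Fin r => S ⊓ L α.rev) fun α => by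
    have := hL α.rev
    rw [Fin.val_rev] at this
    omega
  have h1 : ∑ α, c α ≤ (∑ α, inner ℂ (x α) ((T₁ + T₂) (x α))).re := by
    rw [Complex.re_sum]
    refine Finset.sum_le_sum fun α _ => ?_
    simpa [hx.1 α] using hc α _ (hxM α).2
  have h2 : (∑ α, inner ℂ (y α) (T₁ (y α))).re ≤ ∑ α, a α := by
    rw [Complex.re_sum, ← Equiv.sum_comp Fin.revPerm]
    refine Finset.sum_le_sum fun α _ => ?_
    simpa [hy.1] using ha α (y α.rev) (by simpa using (hyN α.rev).2)
  have h3 : (∑ α, inner ℂ (z α) (T₂ (z α))).re ≤ ∑ α, b α := by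
    rw [Complex.re_sum, ← Equiv.sum_comp Fin.revPerm]
    refine Finset.sum_le_sum fun α _ => ?_
    simpa [hz.1] using hb α (z α.rev) (by simpa using (hzL α.rev).2)
  rw [hx.sum_inner_apply_eq_trace hS' fun α => (hxM α).1, LinearMap.add_comp, LinearMap.comp_add,
    map_add, Complex.add_re] at h1
  rw [hy.sum_inner_apply_eq_trace hS' fun α => (hyN α).1] at h2
  rw [hz.sum_inner_apply_eq_trace hS' fun α => (hzL α).1] at h3
  linarith

theorem Orthonormal.norm_sum_smul_sq {G : Type*} [NormedAddCommGroup G] [InnerProductSpace ℂ G]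
    {ι : Type*} [Fintype ι] {w : ι → G} (hw : Orthonormal ℂ w) (c : ι → ℂ) :
    ‖∑ l, c l • w l‖ ^ 2 = ∑ l, ‖c l‖ ^ 2 := by
  rw [← inner_self_eq_norm_sq (𝕜 := ℂ), hw.inner_sum]
  simp [← Complex.normSq_eq_norm_sq, Complex.normSq_apply]

section Dilation

variable {E F : Type*} [NormedAddCommGroup E] [InnerProductSpace ℂ E]
  [NormedAddCommGroup F] [InnerProductSpace ℂ F]

/-- The operator `(x, y) ↦ (0, 2 A x)` on the `L²` product; the real part of its quadratic form
is that of the Hermitian dilation of `A`. -/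
noncomputable def dilation (A : E →ₗ[ℂ] F) : WithLp 2 (E × F) →ₗ[ℂ] WithLp 2 (E × F) :=
  (2 : ℂ) • ((WithLp.linearEquiv 2 ℂ (E × F)).symm.toLinearMap ∘ₗ LinearMap.inr ℂ E F ∘ₗ A ∘ₗ
    WithLp.fstₗ 2 ℂ E F)

theorem dilation_add (A B : E →ₗ[ℂ] F) : dilation (A + B) = dilation A + dilation B := by
  simp only [dilation, LinearMap.add_comp, LinearMap.comp_add, smul_add]

theorem re_inner_dilation (A : E →ₗ[ℂ] F) (z : WithLp 2 (E × F)) :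
    (inner ℂ z (dilation A z)).re = 2 * (inner ℂ z.snd (A z.fst)).re := by
  simp [dilation]

/-- The span of the pairs `(v l, u l)` with `l < k`. -/
def pairSpan {q : ℕ} (v : Fin q → E) (u : Fin q → F) (k : ℕ) : Submodule ℂ (WithLp 2 (E × F)) :=
  Submodule.span ℂ ((fun l => WithLp.toLp 2 (v l, u l)) '' {l : Fin q | l.val < k})

variable {q : ℕ}

theorem pairSpan_mono (v : Fin q → E) (u : Fin q → F) : Monotone (pairSpan v u) :=
  fun _ _ h => Submodule.span_mono (Set.image_mono fun _ hl => lt_of_lt_of_le hl h)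

theorem finrank_pairSpan {v : Fin q → E} (hv : Orthonormal ℂ v) (u : Fin q → F) {k : ℕ}
    (hk : k ≤ q) : finrank ℂ (pairSpan v u k) = k := by
  have hli : LinearIndependent ℂ fun l => (WithLp.toLp 2 (v l, u l) : WithLp 2 (E × F)) :=
    LinearIndependent.of_comp (WithLp.fstₗ 2 ℂ E F) hv.linearIndependent
  have hset : {l : Fin q | l.val < k} = Set.range (Fin.castLE hk) := by
    ext l
    exact ⟨fun h => ⟨⟨l, h⟩, rfl⟩, by rintro ⟨m, rfl⟩; exact m.2⟩
  rw [pairSpan, hset, ← Set.range_comp, finrank_span_eq_card, Fintype.card_fin]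
  exact hli.comp _ (Fin.castLE_injective hk)

theorem exists_eq_sum_of_mem_pairSpan {v : Fin q → E} {u : Fin q → F} {k : ℕ}
    {z : WithLp 2 (E × F)} (hz : z ∈ pairSpan v u k) :
    ∃ c : Fin q → ℂ, (∀ l, k ≤ l.val → c l = 0) ∧ z.fst = ∑ l, c l • v l ∧
      z.snd = ∑ l, c l • u l := by
  induction hz using Submodule.span_induction with
  | mem z hz =>
    obtain ⟨l, hl, rfl⟩ := hz
    refine ⟨Pi.single l 1, fun m hm => Pi.single_eq_of_ne ?_ _, ?_, ?_⟩
    · rintro rfl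
      exact absurd hl (not_lt.2 hm)
    · simp [Pi.single_apply]
    · simp [Pi.single_apply]
  | zero => exact ⟨0, by simp⟩
  | add z z' _ _ h h' =>
    obtain ⟨c, hc, h1, h2⟩ := h
    obtain ⟨c', hc', h1', h2'⟩ := h'
    exact ⟨c + c', fun l hl => by simp [hc l hl, hc' l hl],
      by simp [h1, h1', add_smul, Finset.sum_add_distrib],
      by simp [h2, h2', add_smul, Finset.sum_add_distrib]⟩
  | smul t z _ h =>
    obtain ⟨c, hc, h1, h2⟩ := h
    exact ⟨t • c, fun l hl => by simp [hc l hl], by simp [h1, Finset.smul_sum, mul_smul],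
      by simp [h2, Finset.smul_sum, mul_smul]⟩

theorem le_re_inner_dilation_of_mem_pairSpan {A : E →ₗ[ℂ] F} {v : Fin q → E} {u : Fin q → F}
    (hv : Orthonormal ℂ v) (hu : Orthonormal ℂ u) {τ : Fin q → ℝ}
    (hA : ∀ l, A (v l) = (τ l : ℂ) • u l) {k : ℕ} {t : ℝ} (ht : ∀ l : Fin q, l.val < k → t ≤ τ l)
    {z : WithLp 2 (E × F)} (hz : z ∈ pairSpan v u k) :
    t * ‖z‖ ^ 2 ≤ (inner ℂ z (dilation A z)).re := by
  obtain ⟨c, hc, h1, h2⟩ := exists_eq_sum_of_mem_pairSpan hz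
  have hA1 : A z.fst = ∑ l, (c l * τ l) • u l := by
    simp [h1, hA, mul_smul]
  rw [re_inner_dilation, hA1, WithLp.prod_norm_sq_eq_of_L2, h1, h2, hv.norm_sum_smul_sq, hu.norm_sum_smul_sq, hu.inner_sum,
    Complex.re_sum, ← two_mul, mul_left_comm, Finset.mul_sum]
  gcongr with l
  rcases lt_or_ge l.val k with hl | hl
  · have : (starRingEnd ℂ (c l) * (c l * τ l)).re = τ l * ‖c l‖ ^ 2 := by
      rw [← mul_assoc, Complex.conj_mul', mul_comm]
      norm_cast
    rw [this]
    exact mul_le_mul_of_nonneg_right (ht l hl) (sq_nonneg _)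
  · simp [hc l hl]

theorem re_inner_dilation_le_of_mem_pairSpan_orthogonal {A : E →ₗ[ℂ] F}
    (v : OrthonormalBasis (Fin q) ℂ E) {u : Fin q → F} (hu : Orthonormal ℂ u) {τ : Fin q → ℝ}
    (hτ : ∀ l, 0 ≤ τ l) (hA : ∀ l, A (v l) = (τ l : ℂ) • u l) {k : ℕ} {t : ℝ} (ht0 : 0 ≤ t)
    (ht : ∀ l : Fin q, k ≤ l.val → τ l ≤ t)
    {z : WithLp 2 (E × F)} (hz : z ∈ (pairSpan v u k)ᗮ) :
    (inner ℂ z (dilation A z)).re ≤ t * ‖z‖ ^ 2 := by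
  have hA1 : inner ℂ z.snd (A z.fst) =
      ∑ l, (τ l : ℂ) * (inner ℂ (v l) z.fst * starRingEnd ℂ (inner ℂ (u l) z.snd)) := by
    conv_lhs => rw [← v.sum_repr' z.fst]
    simp only [map_sum, map_smul, hA, inner_sum, inner_smul_right, inner_conj_symm]
    exact Finset.sum_congr rfl fun l _ => by ring
  have horth : ∀ l : Fin q, l.val < k → inner ℂ (u l) z.snd = -inner ℂ (v l) z.fst := fun l hl => by
    have := (Submodule.mem_orthogonal _ z).1 hz _ (Submodule.subset_span ⟨l, hl, rfl⟩)
    rw [WithLp.prod_inner_apply] at this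
    exact eq_neg_of_add_eq_zero_right this
  have hbound : ∀ l, 2 * ((τ l : ℂ) *
      (inner ℂ (v l) z.fst * starRingEnd ℂ (inner ℂ (u l) z.snd))).re ≤
      t * (‖inner ℂ (v l) z.fst‖ ^ 2 + ‖inner ℂ (u l) z.snd‖ ^ 2) := fun l => by
    rw [Complex.re_ofReal_mul]
    rcases lt_or_ge l.val k with hl | hl
    · rw [horth l hl, map_neg, mul_neg, Complex.mul_conj', Complex.neg_re]
      norm_cast
      have := mul_nonneg (hτ l) (sq_nonneg ‖inner ℂ (v l) z.fst‖)
      have h1 := mul_nonneg ht0 (add_nonneg (sq_nonneg ‖inner ℂ (v l) z.fst‖)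
        (sq_nonneg ‖-inner ℂ (v l) z.fst‖))
      linarith
    · set X := inner ℂ (v l) z.fst
      set Y := inner ℂ (u l) z.snd
      have h1 : 2 * (X * starRingEnd ℂ Y).re ≤ ‖X‖ ^ 2 + ‖Y‖ ^ 2 := by
        have := Complex.re_le_norm (X * starRingEnd ℂ Y)
        rw [norm_mul, Complex.norm_conj] at this
        nlinarith [sq_nonneg (‖X‖ - ‖Y‖)]
      calc 2 * (τ l * (X * starRingEnd ℂ Y).re) = τ l * (2 * (X * starRingEnd ℂ Y).re) := by ring
        _ ≤ τ l * (‖X‖ ^ 2 + ‖Y‖ ^ 2) := mul_le_mul_of_nonneg_left h1 (hτ l)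
        _ ≤ t * (‖X‖ ^ 2 + ‖Y‖ ^ 2) := mul_le_mul_of_nonneg_right (ht l hl) (by positivity)
  rw [re_inner_dilation, hA1, Complex.re_sum, Finset.mul_sum, WithLp.prod_norm_sq_eq_of_L2,
    ← v.sum_sq_norm_inner_right z.fst]
  refine (Finset.sum_le_sum fun l _ => hbound l).trans ?_
  rw [← Finset.mul_sum, Finset.sum_add_distrib]
  gcongr
  exact hu.sum_inner_products_le _

end Dilation

theorem exists_monotone_eq_add {r : ℕ} (hr : 1 ≤ r) {i : Fin r → ℕ} (hi : StrictMono i)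
    (hpos : ∀ α, 1 ≤ i α) : ∃ a : ℕ → ℕ, Monotone a ∧ ∀ α : Fin r, i α = α.val + 1 + a α := by
  have hle : ∀ α : ℕ, ∀ h : α < r, α + 1 ≤ i ⟨α, h⟩ := fun α => by
    induction α with
    | zero => exact fun h => hpos _
    | succ α ih =>
      intro h
      have h1 := ih (by omega)
      have h2 := @hi ⟨α, by omega⟩ ⟨α + 1, h⟩ (Fin.lt_def.2 (by simp))
      omega
  refine ⟨fun α => i ⟨min α (r - 1), by omega⟩ - (min α (r - 1) + 1),
    monotone_nat_of_le_succ fun α => ?_, fun α => ?_⟩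
  · rcases lt_or_ge (α + 1) r with h | h
    · have h1 := @hi ⟨α, by omega⟩ ⟨α + 1, h⟩ (Fin.lt_def.2 (by simp))
      have h2 : min α (r - 1) = α := by omega
      have h3 : min (α + 1) (r - 1) = α + 1 := by omega
      simp only [h2, h3]
      omega
    · have h2 : min α (r - 1) = r - 1 := by omega
      have h3 : min (α + 1) (r - 1) = r - 1 := by omega
      simp only [h2, h3, le_refl]
  · have h1 := hle α α.2
    have h2 : min α.val (r - 1) = α := by omega
    simp only [h2, Fin.eta] at h1 ⊢
    omega

theorem singularValues_nonneg {p q : ℕ} (A : Matrix (Fin p) (Fin q) ℂ) (l : Fin q) :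
    0 ≤ singularValues A l :=
  Real.sqrt_nonneg _

theorem singularValues_antitone {p q : ℕ} (A : Matrix (Fin p) (Fin q) ℂ) :
    Antitone (singularValues A) := fun _ _ h =>
  Real.sqrt_le_sqrt (Tuple.monotone_sort _ (Fin.rev_le_rev.2 h))

open scoped ComplexOrder in
theorem exists_singularValue_decomposition {p q : ℕ} (hpq : q ≤ p)
    (A : Matrix (Fin p) (Fin q) ℂ) :
    ∃ (v : OrthonormalBasis (Fin q) ℂ (EuclideanSpace ℂ (Fin q)))
      (u : Fin q → EuclideanSpace ℂ (Fin p)), Orthonormal ℂ u ∧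
      ∀ l, Matrix.toEuclideanLin A (v l) = (singularValues A l : ℂ) • u l := by
  set hA := Matrix.isHermitian_conjTranspose_mul_self A
  set τ := singularValues A with hτ
  set v := hA.eigenvectorBasis.reindex
    (Fin.revPerm.trans (Tuple.sort hA.eigenvalues)).symm with hv
  have hτsq : ∀ l, τ l ^ 2 = eigsDesc hA l := fun l =>
    Real.sq_sqrt ((Matrix.posSemidef_conjTranspose_mul_self A).eigenvalues_nonneg _)
  have hinner : ∀ l m, inner ℂ (Matrix.toEuclideanLin A (v l)) (Matrix.toEuclideanLin A (v m)) =
      if l = m then ((τ m ^ 2 : ℝ) : ℂ) else 0 := fun l m => by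
    have hvm : Matrix.toEuclideanLin Aᴴ (Matrix.toEuclideanLin A (v m)) =
        ((τ m ^ 2 : ℝ) : ℂ) • v m := by
      have := hA.mulVec_eigenvectorBasis (Tuple.sort hA.eigenvalues m.rev)
      rw [← Matrix.mulVec_mulVec] at this
      rw [hτsq]
      ext i
      simpa [hv, eigsDesc, Matrix.toLpLin_apply] using congrFun this i
    rw [← LinearMap.adjoint_inner_right, ← Matrix.toEuclideanLin_conjTranspose_eq_adjoint, hvm,
      inner_smul_right, orthonormal_iff_ite.1 v.orthonormal]
    simp
  set s : Set (Fin p) := {x | ∃ h : x.val < q, τ ⟨x, h⟩ ≠ 0} with hs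
  set w : Fin p → EuclideanSpace ℂ (Fin p) := fun x =>
    if h : x.val < q then ((τ ⟨x, h⟩ : ℂ)⁻¹) • Matrix.toEuclideanLin A (v ⟨x, h⟩) else 0 with hw
  have hws : Orthonormal ℂ (s.domRestrict w) := by
    rw [orthonormal_iff_ite]
    rintro ⟨x, hx, hx0⟩ ⟨y, hy, hy0⟩
    simp only [Set.domRestrict_apply, hw, hx, hy, dif_pos, inner_smul_left, inner_smul_right,
      hinner, Subtype.mk.injEq, Fin.ext_iff]
    split_ifs with hxy
    · obtain rfl := Fin.ext hxy
      have : (τ ⟨x, hx⟩ : ℂ) ≠ 0 := by exact_mod_cast hx0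
      simp
      field_simp
    · simp
  obtain ⟨b, hb⟩ := hws.exists_orthonormalBasis_extension_of_card_eq (by simp)
  refine ⟨v, fun l => b (Fin.castLE hpq l), b.orthonormal.comp _ (Fin.castLE_injective hpq),
    fun l => ?_⟩
  by_cases h0 : τ l = 0
  · have := hinner l l
    rw [if_pos rfl, h0, inner_self_eq_norm_sq_to_K] at this
    simpa [h0] using this
  · have h0' : (τ l : ℂ) ≠ 0 := by exact_mod_cast h0
    have hbl := hb (Fin.castLE hpq l) ⟨l.2, h0⟩
    simp only [hbl, hw, Fin.val_castLE, l.2, dif_pos, Fin.eta]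
    rw [smul_smul, mul_inv_cancel₀ h0', one_smul]

/-- **Thompson inequality for singular values.**  For `p ≥ q ≥ 1`, complex `p × q`
matrices `A`, `B`, and subsets `{i_1 < … < i_r}`, `{j_1 < … < j_r}` of `[q]`
(encoded by strictly monotone maps `i j : Fin r → ℕ` with values in `[q]`)
satisfying `i_r + j_r − r ≤ q`, one has
`∑_{α=1}^r τ_{i_α + j_α − α}(A+B) ≤ ∑_{α=1}^r τ_{i_α}(A) + ∑_{α=1}^r τ_{j_α}(B)`. -/
theorem thompson_inequality_singular_values (p q r : ℕ) (hq : 1 ≤ q) (hpq : q ≤ p)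
    (hr : 1 ≤ r) (A B : Matrix (Fin p) (Fin q) ℂ)
    (i j : Fin r → ℕ) (hi : StrictMono i) (hj : StrictMono j)
    (hirange : ∀ α, 1 ≤ i α ∧ i α ≤ q) (hjrange : ∀ α, 1 ≤ j α ∧ j α ≤ q)
    (hlast : i ⟨r - 1, by omega⟩ + j ⟨r - 1, by omega⟩ - r ≤ q) :
    ∑ α : Fin r, sval (A + B) (i α + j α - (α.val + 1)) ≤
      ∑ α : Fin r, sval A (i α) + ∑ α : Fin r, sval B (j α) := by
  obtain ⟨a, ha, hia⟩ := exists_monotone_eq_add hr hi fun α => (hirange α).1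
  obtain ⟨b, hb, hjb⟩ := exists_monotone_eq_add hr hj fun α => (hjrange α).1
  have hk : ∀ α : Fin r, α.val + 1 + a α + b α ≤ q := fun α => by
    have h1 := hia ⟨r - 1, by omega⟩
    have h2 := hjb ⟨r - 1, by omega⟩
    have h3 : α.val ≤ r - 1 := by omega
    have h4 := ha h3
    have h5 := hb h3
    simp only at h1 h2
    omega
  obtain ⟨vA, uA, huA, hA⟩ := exists_singularValue_decomposition hpq A
  obtain ⟨vB, uB, huB, hB⟩ := exists_singularValue_decomposition hpq B
  obtain ⟨vC, uC, huC, hC⟩ := exists_singularValue_decomposition hpq (A + B)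
  obtain ⟨S, hS, hSf⟩ := Submodule.exists_finrank_inf_flags (K := ℂ) r
    (M := fun α => pairSpan vC uC (α + 1 + a α + b α))
    (N := fun α => (pairSpan vA uA (α + a α))ᗮ) (L := fun α => (pairSpan vB uB (α + b α))ᗮ)
    (a := a) (b := b)
    (fun α β h => pairSpan_mono _ _ (by have := ha h; have := hb h; omega))
    (fun α β h => Submodule.orthogonal_le (pairSpan_mono _ _ (by have := ha h; omega)))
    (fun α β h => Submodule.orthogonal_le (pairSpan_mono _ _ (by have := hb h; omega)))
    ha hb
    (fun α hα => (finrank_pairSpan vC.orthonormal uC (hk ⟨α, hα⟩)).ge)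
    (fun α hα => by
      have h1 := hk ⟨α, hα⟩
      simp only at h1
      rw [← Submodule.finrank_add_finrank_orthogonal (pairSpan vA uA (α + a α)),
        finrank_pairSpan vA.orthonormal uA (by omega)]
      omega)
    (fun α hα => by
      have h1 := hk ⟨α, hα⟩
      simp only at h1
      rw [← Submodule.finrank_add_finrank_orthogonal (pairSpan vB uB (α + b α)),
        finrank_pairSpan vB.orthonormal uB (by omega)]
      omega)
  refine sum_le_sum_add_sum_of_flags hS (dilation (Matrix.toEuclideanLin A))
    (dilation (Matrix.toEuclideanLin B)) (fun α => (hSf α α.2).1) (fun α => (hSf α α.2).2.1)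
    (fun α => (hSf α α.2).2.2) (fun α x hx => ?_) (fun α x hx => ?_) (fun α x hx => ?_)
  · rw [← dilation_add, ← map_add]
    refine le_re_inner_dilation_of_mem_pairSpan vC.orthonormal huC hC (fun l hl => ?_) hx
    have h1 := hia α
    have h2 := hjb α
    have h3 := hk α
    rw [sval, dif_pos (by omega)]
    exact singularValues_antitone _ (Fin.le_def.2 (by simp only; omega))
  · have h1 := hia α
    have h3 := hk α
    have h4 : i α - 1 < q := by omega
    rw [sval, dif_pos h4]
    exact re_inner_dilation_le_of_mem_pairSpan_orthogonal vA huA (singularValues_nonneg A) hA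
      (singularValues_nonneg A _)
      (fun l hl => singularValues_antitone _ (Fin.le_def.2 (by simp only; omega))) hx
  · have h1 := hjb α
    have h3 := hk α
    have h4 : j α - 1 < q := by omega
    rw [sval, dif_pos h4]
    exact re_inner_dilation_le_of_mem_pairSpan_orthogonal vB huB (singularValues_nonneg B) hB
      (singularValues_nonneg B _)
      (fun l hl => singularValues_antitone _ (Fin.le_def.2 (by simp only; omega))) hx
end
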